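/- arXiv:math/0701646 — 14 statements merged into one kernel-verified Lean document; each statement's English description precedes it below -/
import Mathlib

section
/- Let σ : ℝ → ℝ be continuous, W(w) = ∫_0^w σ(y) dy, U(v,w) = W(w) + v²/2 and F(v,w) = −σ(w)·v. Suppose real numbers v_−, w_−, v_+, w_+ and a nonzero speed V satisfy the Rankine–Hugoniot relations V·(w_+ − w_−) + (v_+ − v_−) = 0 and V·(v_+ − v_−) + σ(w_+) − σ(w_−) = 0. Then the entropy dissipation satisfies −(U(v_+,w_+) − U(v_−,w_−)) + (1/V)·(F(v_+,w_+) − F(v_−,w_−)) = −∫_{w_−}^{w_+} ( σ(y) − (σ(w_+) + σ(w_−))/2 ) dy. -/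
open intervalIntegral

/-- Lemma 1.1: across a discontinuity of speed `V ≠ 0` satisfying the
Rankine–Hugoniot relations for the p-system, the entropy dissipation
depends only on the strains. -/
theorem stmt_0 (σ : ℝ → ℝ) (hσ : Continuous σ)
    (W : ℝ → ℝ) (hW : ∀ w, W w = ∫ y in (0:ℝ)..w, σ y)
    (U : ℝ → ℝ → ℝ) (hU : ∀ v w, U v w = W w + v ^ 2 / 2)
    (F : ℝ → ℝ → ℝ) (hF : ∀ v w, F v w = -σ w * v)
    (vm wm vp wp V : ℝ) (hV : V ≠ 0)
    (hRH1 : V * (wp - wm) + (vp - vm) = 0)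
    (hRH2 : V * (vp - vm) + σ wp - σ wm = 0) :
    -(U vp wp - U vm wm) + (1 / V) * (F vp wp - F vm wm) =
      -∫ y in wm..wp, (σ y - (σ wp + σ wm) / 2) := by
  have hint : ∀ a b, IntervalIntegrable σ MeasureTheory.volume a b :=
    fun a b => hσ.intervalIntegrable a b
  have hdiff : W wp - W wm = ∫ y in wm..wp, σ y := by
    rw [hW, hW, integral_interval_sub_left (hint 0 wp) (hint 0 wm)]
  have hflux : (1 / V) * (F vp wp - F vm wm) =
      (vp ^ 2 - vm ^ 2) / 2 + (wp - wm) * ((σ wp + σ wm) / 2) := by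
    rw [one_div, inv_mul_eq_iff_eq_mul₀ hV, hF, hF]
    linear_combination (-(vp + vm) / 2) * hRH2 - ((σ wp + σ wm) / 2) * hRH1
  rw [integral_sub (hint wm wp) intervalIntegrable_const, integral_const, smul_eq_mul, hflux,
    hU, hU]
  linear_combination -hdiff
end

section
/- Let w_−, w_+ be real numbers with −1 < w_− ≤ w_M and w_+ ≥ w_m. Then ∫_{w_−}^{w_+} ( σ(y) − (σ(w_+) + σ(w_−))/2 ) dy = ((k1 − k3)/2)·(w_M·w_m − w_+·w_−). -/
open MeasureTheory in
/-- The trapezoidal rule is exact for functions that are affine on the interval. -/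
theorem intervalIntegrable_and_integral_eq_trapezoid {f : ℝ → ℝ} {a b p q : ℝ} (hab : a ≤ b)
    (hf : ∀ y ∈ Set.Icc a b, f y = p * y + q) :
    IntervalIntegrable f volume a b ∧ ∫ y in a..b, f y = (b - a) * (f a + f b) / 2 := by
  have hf' : Set.EqOn f (fun y => p * y + q) (Set.uIcc a b) := by
    rwa [Set.uIcc_of_le hab]
  have hp : IntervalIntegrable (fun y : ℝ => p * y) volume a b :=
    Continuous.intervalIntegrable (by fun_prop) a b
  refine ⟨ContinuousOn.intervalIntegrable (ContinuousOn.congr (by fun_prop) hf'), ?_⟩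
  rw [intervalIntegral.integral_congr hf', intervalIntegral.integral_add hp (by simp),
    intervalIntegral.integral_const_mul, integral_id, intervalIntegral.integral_const,
    hf a ⟨le_rfl, hab⟩, hf b ⟨hab, le_rfl⟩, smul_eq_mul]
  ring

/-- Equation (2.7): for the piecewise linear stress, the entropy dissipation
integral across a phase boundary joining a phase-1 strain `w₋` to a
phase-3 strain `w₊` equals `((k1 − k3)/2)·(w_M·w_m − w₊·w₋)`. -/
theorem stmt_1 (k1 k3 wM wm : ℝ)
    (hk3 : 0 < k3) (hk13 : k3 < k1) (hwM : 0 < wM) (hwMm : wM < wm)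
    (σ : ℝ → ℝ)
    (hσ1 : ∀ w : ℝ, -1 < w → w ≤ wM → σ w = k1 * w)
    (hσ2 : ∀ w : ℝ, wM ≤ w → w ≤ wm →
      σ w = k3 * wm + (k1 * wM - k3 * wm) * (w - wm) / (wM - wm))
    (hσ3 : ∀ w : ℝ, wm ≤ w → σ w = k3 * w)
    (wminus wplus : ℝ)
    (h1 : -1 < wminus) (h2 : wminus ≤ wM) (h3 : wm ≤ wplus) :
    (∫ y in wminus..wplus, (σ y - (σ wplus + σ wminus) / 2)) =
      ((k1 - k3) / 2) * (wM * wm - wplus * wminus) := by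
  obtain ⟨i1, e1⟩ := intervalIntegrable_and_integral_eq_trapezoid (f := σ) (p := k1) (q := 0) h2
    fun y hy => by rw [hσ1 y (h1.trans_le hy.1) hy.2, add_zero]
  obtain ⟨i2, e2⟩ := intervalIntegrable_and_integral_eq_trapezoid (f := σ)
    (p := (k1 * wM - k3 * wm) / (wM - wm))
    (q := k3 * wm - (k1 * wM - k3 * wm) / (wM - wm) * wm) hwMm.le
    fun y hy => by rw [hσ2 y hy.1 hy.2]; ring
  obtain ⟨i3, e3⟩ := intervalIntegrable_and_integral_eq_trapezoid (f := σ) (p := k3) (q := 0) h3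
    fun y hy => by rw [hσ3 y hy.1, add_zero]
  rw [intervalIntegral.integral_sub ((i1.trans i2).trans i3) (by simp),
    ← intervalIntegral.integral_add_adjacent_intervals (i1.trans i2) i3,
    ← intervalIntegral.integral_add_adjacent_intervals i1 i2, e1, e2, e3,
    intervalIntegral.integral_const, smul_eq_mul, hσ1 wminus h1 h2, hσ1 wM (h1.trans_le h2) le_rfl,
    hσ3 wm le_rfl, hσ3 wplus h3]
  ring
end

section
/- Let 0 < c3 < c1 and let V be a real number with V ≠ −c1 and V ≠ c3. Given any states (v_L, w_L) and (v_R, w_R), the linear system of four Rankine–Hugoniot relations c1·(w_− − w_L) − (v_− − v_L) = 0, V·(w_+ − w_−) + (v_+ − v_−) = 0, V·(v_+ − v_−) + c3²·w_+ − c1²·w_− = 0, c3·(w_+ − w_R) + (v_+ − v_R) = 0 in the unknowns (v_−, w_−, v_+, w_+) has a unique solution, given explicitly by v_− = v_L − c1·w_L + ((c3 + V)/(c1 + V))·c1·h_LR, w_− = ((c3 + V)/(c1 + V))·h_LR, v_+ = v_R + c3·w_R − ((c1 − V)/(c3 − V))·c3·h_LR, w_+ = ((c1 − V)/(c3 − V))·h_LR.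 -/
/-- The one-parameter family (2.6): for `V ≠ −c1`, `V ≠ c3`, the four
Rankine–Hugoniot relations (2.5) determine `(v₋, w₋, v₊, w₊)` uniquely,
with the stated explicit formulas in terms of the averaged strain `h_LR`. -/
theorem stmt_2 (c1 c3 V vL wL vR wR hLR : ℝ)
    (hc3 : 0 < c3) (hc13 : c3 < c1) (hV1 : V ≠ -c1) (hV2 : V ≠ c3)
    (hh : hLR = (c1 * wL + c3 * wR + vR - vL) / (c1 + c3)) :
    ∀ vm wm vp wp : ℝ,
      (c1 * (wm - wL) - (vm - vL) = 0 ∧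
       V * (wp - wm) + (vp - vm) = 0 ∧
       V * (vp - vm) + c3 ^ 2 * wp - c1 ^ 2 * wm = 0 ∧
       c3 * (wp - wR) + (vp - vR) = 0) ↔
      (vm = vL - c1 * wL + ((c3 + V) / (c1 + V)) * c1 * hLR ∧
       wm = ((c3 + V) / (c1 + V)) * hLR ∧
       vp = vR + c3 * wR - ((c1 - V) / (c3 - V)) * c3 * hLR ∧
       wp = ((c1 - V) / (c3 - V)) * hLR) := by
  intro vm wm vp wp
  have hc : c1 + c3 ≠ 0 := by linarith
  have hm : c1 + V ≠ 0 := fun h => hV1 (by linarith)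
  have hp : c3 - V ≠ 0 := fun h => hV2 (by linarith)
  have hS : hLR * (c1 + c3) = c1 * wL + c3 * wR + vR - vL := by
    rw [hh, div_mul_cancel₀ _ hc]
  constructor
  · rintro ⟨h1, h2, h3, h4⟩
    have hwm : wm = (c3 + V) / (c1 + V) * hLR := by
      rw [div_mul_eq_mul_div, eq_div_iff hm]
      apply mul_left_cancel₀ hc
      linear_combination -(c3 + V) * hS + (c3 + V) * h1 - c3 * h2 - h3 + (c3 + V) * h4
    have hwp : wp = (c1 - V) / (c3 - V) * hLR := by
      rw [div_mul_eq_mul_div, eq_div_iff hp]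
      apply mul_left_cancel₀ hc
      linear_combination -(c1 - V) * hS + (c1 - V) * h1 - c1 * h2 + h3 + (c1 - V) * h4
    refine ⟨?_, hwm, ?_, hwp⟩
    · linear_combination -h1 + c1 * hwm
    · linear_combination h4 - c3 * hwp
  · rintro ⟨hvm, hwm, hvp, hwp⟩
    have hb : wm * (c1 + V) = (c3 + V) * hLR := by
      rw [hwm]; field_simp
    have ha : wp * (c3 - V) = (c1 - V) * hLR := by
      rw [hwp]; field_simp
    have h1 : c1 * (wm - wL) - (vm - vL) = 0 := by
      linear_combination c1 * hwm - hvm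
    have h4 : c3 * (wp - wR) + (vp - vR) = 0 := by
      linear_combination c3 * hwp + hvp
    refine ⟨h1, ?_, ?_, h4⟩
    · linear_combination h1 + h4 - ha - hb - hS
    · linear_combination V * h1 + V * h4 + c3 * ha - c1 * hb - V * hS
end

section
/- Let h > 0. The function θ(V) = ((k1 − k3)/2)·(w_M·w_m − (((c3 + V)·(c1 − V))/((c1 + V)·(c3 − V)))·h²) is strictly decreasing on (−c3, c3), satisfies θ(V) → ((k1 − k3)/2)·w_M·w_m as V → −c3⁺, and θ(V) → −∞ as V → c3⁻. -/
open Set Filter Topology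

/-- The ratio `((b + V) * (a - V)) / ((a + V) * (b - V))` is strictly increasing in `V` on
`(-b, b)` when `b < a`. -/
theorem div_lt_div_of_speeds {a b U V : ℝ} (hab : b < a)
    (hU : U ∈ Ioo (-b) b) (hV : V ∈ Ioo (-b) b) (hUV : U < V) :
    ((b + U) * (a - U)) / ((a + U) * (b - U)) < ((b + V) * (a - V)) / ((a + V) * (b - V)) := by
  obtain ⟨hU1, hU2⟩ := hU
  obtain ⟨hV1, hV2⟩ := hV
  rw [div_lt_div_iff₀ (mul_pos (by linarith) (by linarith)) (mul_pos (by linarith) (by linarith))]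
  have hb : 0 < b := by linarith
  have hprod : 0 < a * b + U * V := by
    nlinarith [mul_pos (sub_pos.mpr hab) hb, mul_pos (sub_pos.mpr hU2) (sub_pos.mpr hV1),
      mul_pos (sub_pos.mpr hU1) (sub_pos.mpr hV2)]
  have := mul_pos (mul_pos (sub_pos.mpr hab) (sub_pos.mpr hUV)) hprod
  linarith

/-- Properties of the entropy-dissipation function `θ` of (2.8):
strictly decreasing on `(−c3, c3)`, with limit `((k1−k3)/2)·w_M·w_m`
as `V → −c3⁺` and limit `−∞` as `V → c3⁻`. -/
theorem stmt_4 (k1 k3 wM wm c1 c3 h : ℝ)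
    (hk3 : 0 < k3) (hk13 : k3 < k1) (hwM : 0 < wM) (hwMm : wM < wm)
    (hc1 : c1 = Real.sqrt k1) (hc3 : c3 = Real.sqrt k3) (hh : 0 < h)
    (θ : ℝ → ℝ)
    (hθ : ∀ V, θ V = ((k1 - k3) / 2) *
      (wM * wm - (((c3 + V) * (c1 - V)) / ((c1 + V) * (c3 - V))) * h ^ 2)) :
    StrictAntiOn θ (Ioo (-c3) c3) ∧
    Tendsto θ (nhdsWithin (-c3) (Ioi (-c3))) (nhds (((k1 - k3) / 2) * (wM * wm))) ∧
    Tendsto θ (nhdsWithin c3 (Iio c3)) atBot := by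
  have hc3pos : 0 < c3 := hc3 ▸ Real.sqrt_pos.mpr hk3
  have hlt : c3 < c1 := by
    rw [hc1, hc3]
    exact Real.sqrt_lt_sqrt hk3.le hk13
  have hk : 0 < (k1 - k3) / 2 := by linarith
  have hh2 : 0 < h ^ 2 := by positivity
  obtain rfl : θ = _ := funext hθ
  refine ⟨?_, ?_, ?_⟩
  · intro U hU V hV hUV
    have key := div_lt_div_of_speeds hlt hU hV hUV
    have := mul_lt_mul_of_pos_right key hh2
    exact mul_lt_mul_of_pos_left (by linarith) hk
  · have hD : (c1 + -c3) * (c3 - -c3) ≠ 0 :=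
      mul_ne_zero (by linarith) (by linarith)
    have hcont : ContinuousAt (fun V : ℝ => ((k1 - k3) / 2) *
        (wM * wm - (((c3 + V) * (c1 - V)) / ((c1 + V) * (c3 - V))) * h ^ 2)) (-c3) := by
      fun_prop (disch := assumption)
    have := hcont.tendsto.mono_left (nhdsWithin_le_nhds (s := Ioi (-c3)))
    simpa using this
  · have hinv : Tendsto (fun V : ℝ => (c3 - V)⁻¹) (𝓝[<] c3) atTop := by
      refine tendsto_inv_nhdsGT_zero.comp (tendsto_nhdsWithin_iff.mpr ⟨?_, ?_⟩)
      · have : ContinuousAt (fun V : ℝ => c3 - V) c3 := by fun_prop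
        simpa using this.tendsto.mono_left (nhdsWithin_le_nhds (s := Iio c3))
      · filter_upwards [self_mem_nhdsWithin] with V hV
        exact sub_pos.mpr (mem_Iio.mp hV)
    have hD : c1 + c3 ≠ 0 := by linarith
    have hcont : ContinuousAt (fun V : ℝ => (c3 + V) * (c1 - V) / (c1 + V)) c3 := by
      fun_prop (disch := assumption)
    have hpos : 0 < (c3 + c3) * (c1 - c3) / (c1 + c3) :=
      div_pos (mul_pos (by linarith) (by linarith)) (by linarith)
    have hratio := (hcont.tendsto.mono_left
      (nhdsWithin_le_nhds (s := Iio c3))).pos_mul_atTop hpos hinv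
    have hbot := (tendsto_atBot_add_const_left _ (wM * wm)
      (tendsto_neg_atTop_atBot.comp (hratio.atTop_mul_const hh2))).const_mul_atBot hk
    refine hbot.congr fun V => ?_
    simp only [Function.comp_apply, ← div_eq_mul_inv, div_div, ← sub_eq_add_neg]
end

section
/- Let φ : (−c3, c3) → ℝ be continuous, nondecreasing, and satisfy φ(V) → −∞ as V → −c3⁺. Then for every h > 0 the equation θ(V) = φ(V) has exactly one solution V in the open interval (−c3, c3). -/
open Set Filter Topology

/-- For `0 < b < a`, the quotient `(b + V)(a - V) / ((a + V)(b - V))` is strictly increasing on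
`(-b, b)`. -/
lemma strictMonoOn_kinetic_quotient {a b : ℝ} (hb : 0 < b) (hab : b < a) :
    StrictMonoOn (fun V : ℝ => ((b + V) * (a - V)) / ((a + V) * (b - V))) (Ioo (-b) b) := by
  rintro x ⟨hx₁, hx₂⟩ y ⟨hy₁, hy₂⟩ hxy
  have hDx : 0 < (a + x) * (b - x) := mul_pos (by linarith) (by linarith)
  have hDy : 0 < (a + y) * (b - y) := mul_pos (by linarith) (by linarith)
  have hpos : 0 < a * b + x * y := by
    have h₁ : 0 < (b + x) * (b + y) := mul_pos (by linarith) (by linarith)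
    have h₂ : 0 < (b - x) * (b - y) := mul_pos (by linarith) (by linarith)
    have h₃ : 0 < b * (a - b) := mul_pos hb (by linarith)
    linarith
  have key : 0 < (a - b) * ((y - x) * (a * b + x * y)) :=
    mul_pos (by linarith) (mul_pos (by linarith) hpos)
  change _ / _ < _ / _
  rw [div_lt_div_iff₀ hDx hDy]
  linarith

/-- The kinetic-relation equation (2.8): for every `h > 0`, the equation
`θ(V) = φ(V)` has exactly one root `V` in `(−c3, c3)`. -/
theorem stmt_5 (k1 k3 wM wm c1 c3 : ℝ)
    (hk3 : 0 < k3) (hk13 : k3 < k1) (hwM : 0 < wM) (hwMm : wM < wm)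
    (hc1 : c1 = Real.sqrt k1) (hc3 : c3 = Real.sqrt k3)
    (φ : ℝ → ℝ)
    (hφc : ContinuousOn φ (Ioo (-c3) c3))
    (hφm : MonotoneOn φ (Ioo (-c3) c3))
    (hφlim : Tendsto φ (nhdsWithin (-c3) (Ioi (-c3))) atBot)
    (θ : ℝ → ℝ → ℝ)
    (hθ : ∀ h V, θ h V = ((k1 - k3) / 2) *
      (wM * wm - (((c3 + V) * (c1 - V)) / ((c1 + V) * (c3 - V))) * h ^ 2)) :
    ∀ h : ℝ, 0 < h → ∃! V : ℝ, V ∈ Ioo (-c3) c3 ∧ θ h V = φ V := by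
  intro h hh
  have hc3pos : 0 < c3 := hc3 ▸ Real.sqrt_pos.2 hk3
  have hc31 : c3 < c1 := by
    rw [hc1, hc3]
    exact Real.sqrt_lt_sqrt hk3.le hk13
  have hK : 0 < (k1 - k3) / 2 := by linarith
  have hh2 : 0 < h ^ 2 := by positivity
  have hanti : StrictAntiOn (θ h) (Ioo (-c3) c3) := by
    intro x hx y hy hxy
    rw [hθ, hθ]
    exact mul_lt_mul_of_pos_left (sub_lt_sub_left
      (mul_lt_mul_of_pos_right (strictMonoOn_kinetic_quotient hc3pos hc31 hx hy hxy) hh2) _) hK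
  have hcont : ContinuousOn (θ h) (Ioo (-c3) c3) := by
    have hθ' : θ h = fun V => ((k1 - k3) / 2) *
        (wM * wm - (((c3 + V) * (c1 - V)) / ((c1 + V) * (c3 - V))) * h ^ 2) := funext (hθ h)
    rw [hθ']
    refine continuousOn_const.mul (continuousOn_const.sub
      (ContinuousOn.mul (ContinuousOn.div (by fun_prop) (by fun_prop) ?_) continuousOn_const))
    rintro V ⟨hV₁, hV₂⟩
    exact (mul_pos (by linarith) (by linarith)).ne'
  have h0 : (0 : ℝ) ∈ Ioo (-c3) c3 := ⟨by linarith, hc3pos⟩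
  obtain ⟨a, ha, hφa⟩ : ∃ a ∈ Ioo (-c3) c3, φ a ≤ θ h a := by
    obtain ⟨a, hφa, ha⟩ := ((hφlim.eventually (eventually_le_atBot (θ h 0))).and
      (Ioo_mem_nhdsGT h0.1)).exists
    have ha' : a ∈ Ioo (-c3) c3 := ⟨ha.1, ha.2.trans hc3pos⟩
    exact ⟨a, ha', hφa.trans (hanti ha' h0 ha.2).le⟩
  obtain ⟨b, hb, hφb⟩ : ∃ b ∈ Ioo (-c3) c3, θ h b ≤ φ b := by
    set C := wM * wm - φ 0 / ((k1 - k3) / 2) with hC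
    have hlim : ∀ᶠ V in 𝓝[<] c3,
        C * ((c1 + V) * (c3 - V)) < (c3 + V) * (c1 - V) * h ^ 2 := by
      refine nhdsWithin_le_nhds (ContinuousAt.eventually_lt (by fun_prop) (by fun_prop) ?_)
      have : 0 < (c3 + c3) * (c1 - c3) * h ^ 2 :=
        mul_pos (mul_pos (by linarith) (by linarith)) hh2
      simpa using this
    obtain ⟨b, hCb, hb⟩ := (hlim.and (Ioo_mem_nhdsLT hc3pos)).exists
    have hb' : b ∈ Ioo (-c3) c3 := ⟨h0.1.trans hb.1, hb.2⟩
    refine ⟨b, hb', le_trans ?_ (hφm h0 hb' hb.1.le)⟩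
    have hD : 0 < (c1 + b) * (c3 - b) := mul_pos (by linarith [hb.1]) (by linarith [hb.2])
    rw [← lt_div_iff₀ hD, mul_div_right_comm] at hCb
    rw [hθ, ← le_div_iff₀' hK]
    linarith
  obtain ⟨V, hV, hVeq⟩ := isPreconnected_Ioo.intermediate_value₂ hb ha hcont hφc hφb hφa
  refine ⟨V, ⟨hV, hVeq⟩, ?_⟩
  rintro W ⟨hW, hWeq⟩
  rcases lt_trichotomy W V with hlt | heq | hlt
  · linarith [hanti hW hV hlt, hφm hW hV hlt.le]
  · exact heq
  · linarith [hanti hV hW hlt, hφm hV hW hlt.le]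
end

section
/- Let V ∈ (−c3, c3) and h > 0, and suppose ψ̲(V) ≤ θ(V), where ψ̲(V) = ((k1 − k3)/2)·w_M·(w_m − ((k1 − V²)/(k3 − V²))·w_M). Then w_− := ((c3 + V)/(c1 + V))·h satisfies w_− ≤ w_M, i.e. the state to the left of the phase boundary lies in the phase-1 region. -/
open Set

/-- Consistency (2.9), left state: if `ψ̲(V) ≤ θ(V)` then
`w₋ = ((c3+V)/(c1+V))·h ≤ w_M`, i.e. the left state is in phase 1. -/
theorem stmt_6 (k1 k3 wM wm c1 c3 h V : ℝ)
    (hk3 : 0 < k3) (hk13 : k3 < k1) (hwM : 0 < wM) (hwMm : wM < wm)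
    (hc1 : c1 = Real.sqrt k1) (hc3 : c3 = Real.sqrt k3)
    (hV : V ∈ Ioo (-c3) c3) (hh : 0 < h)
    (hψθ : ((k1 - k3) / 2) * wM * (wm - ((k1 - V ^ 2) / (k3 - V ^ 2)) * wM) ≤
      ((k1 - k3) / 2) *
        (wM * wm - (((c3 + V) * (c1 - V)) / ((c1 + V) * (c3 - V))) * h ^ 2)) :
    ((c3 + V) / (c1 + V)) * h ≤ wM := by
  obtain ⟨hV₁, hV₂⟩ := hV
  have hc3_lt : c3 < c1 := by
    rw [hc1, hc3]
    exact Real.sqrt_lt_sqrt hk3.le hk13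
  have hk1_eq : k1 = c1 ^ 2 := by rw [hc1, Real.sq_sqrt (hk3.trans hk13).le]
  have hk3_eq : k3 = c3 ^ 2 := by rw [hc3, Real.sq_sqrt hk3.le]
  have h1p : 0 < c1 + V := by linarith
  have h1m : 0 < c1 - V := by linarith
  have h3p : 0 < c3 + V := by linarith
  have h3m : 0 < c3 - V := by linarith
  have hratio : (k1 - V ^ 2) / (k3 - V ^ 2) =
      ((c1 + V) * (c1 - V)) / ((c3 + V) * (c3 - V)) := by
    rw [hk1_eq, hk3_eq, sq_sub_sq, sq_sub_sq]
  have hpos : 0 < (k1 - V ^ 2) / (k3 - V ^ 2) := by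
    rw [hratio]
    positivity
  have hfactor : ((c3 + V) * (c1 - V)) / ((c1 + V) * (c3 - V)) * h ^ 2 =
      (k1 - V ^ 2) / (k3 - V ^ 2) * ((c3 + V) / (c1 + V) * h) ^ 2 := by
    rw [hratio]
    field_simp
  rw [hfactor, mul_assoc] at hψθ
  have hle := le_of_mul_le_mul_left hψθ (half_pos (sub_pos.mpr hk13))
  refine abs_le_of_sq_le_sq' ?_ hwM.le |>.2
  refine le_of_mul_le_mul_left ?_ hpos
  linarith
end

section
/- Let V ∈ (−c3, c3) and h > 0, and suppose θ(V) ≤ ψ̄(V), where ψ̄(V) = ((k1 − k3)/2)·w_m·(w_M − ((k3 − V²)/(k1 − V²))·w_m). Then w_+ := ((c1 − V)/(c3 − V))·h satisfies w_+ ≥ w_m, i.e. the state to the right of the phase boundary lies in the phase-3 region. -/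
open Set

/-- Consistency (2.9), right state: if `θ(V) ≤ ψ̄(V)` then
`w₊ = ((c1−V)/(c3−V))·h ≥ w_m`, i.e. the right state is in phase 3. -/
theorem stmt_7 (k1 k3 wM wm c1 c3 h V : ℝ)
    (hk3 : 0 < k3) (hk13 : k3 < k1) (hwM : 0 < wM) (hwMm : wM < wm)
    (hc1 : c1 = Real.sqrt k1) (hc3 : c3 = Real.sqrt k3)
    (hV : V ∈ Ioo (-c3) c3) (hh : 0 < h)
    (hθψ : ((k1 - k3) / 2) *
        (wM * wm - (((c3 + V) * (c1 - V)) / ((c1 + V) * (c3 - V))) * h ^ 2) ≤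
      ((k1 - k3) / 2) * wm * (wM - ((k3 - V ^ 2) / (k1 - V ^ 2)) * wm)) :
    wm ≤ ((c1 - V) / (c3 - V)) * h := by
  obtain ⟨hVl, hVr⟩ := hV
  have hk1 : 0 < k1 := hk3.trans hk13
  have hc31 : c3 < c1 := by rw [hc1, hc3]; exact Real.sqrt_lt_sqrt hk3.le hk13
  have hsq1 : k1 = c1 ^ 2 := by rw [hc1, Real.sq_sqrt hk1.le]
  have hsq3 : k3 = c3 ^ 2 := by rw [hc3, Real.sq_sqrt hk3.le]
  have h3m : 0 < c3 - V := by linarith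
  have h3p : 0 < c3 + V := by linarith
  have h1m : 0 < c1 - V := by linarith
  have h1p : 0 < c1 + V := by linarith
  have hratio : (k3 - V ^ 2) / (k1 - V ^ 2) = (c3 - V) * (c3 + V) / ((c1 - V) * (c1 + V)) := by
    rw [hsq1, hsq3]
    congr 1 <;> ring
  have hweight : (c3 + V) * (c1 - V) / ((c1 + V) * (c3 - V)) * h ^ 2 =
      (c3 - V) * (c3 + V) / ((c1 - V) * (c1 + V)) * ((c1 - V) / (c3 - V) * h) ^ 2 := by
    field_simp
  rw [hratio, hweight, mul_assoc] at hθψ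
  have hle := le_of_mul_le_mul_left hθψ (by linarith : 0 < (k1 - k3) / 2)
  have hpos : 0 < (c3 - V) * (c3 + V) / ((c1 - V) * (c1 + V)) := by positivity
  have hsq : wm ^ 2 ≤ ((c1 - V) / (c3 - V) * h) ^ 2 :=
    le_of_mul_le_mul_left (by linarith) hpos
  exact (abs_le_of_sq_le_sq' hsq (by positivity)).2
end

section
/- The function ψ̲(V) = ((k1 − k3)/2)·w_M·(w_m − ((k1 − V²)/(k3 − V²))·w_M) is strictly increasing on (−c3, 0] and satisfies ψ̲(V) → −∞ as V → −c3⁺. If moreover k3·w_m < k1·w_M, then ψ̲(V) < 0 for every V ∈ (−c3, 0]. -/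
open Set Filter Topology

/-- Points of `(-√k, 0]` have square less than `k`. -/
lemma sub_sq_pos_of_neg_sqrt_lt {k V : ℝ} (hk : 0 < k) (hV : -√k < V) (hV0 : V ≤ 0) :
    0 < k - V ^ 2 := by
  nlinarith [Real.sq_sqrt hk.le, Real.sqrt_nonneg k]

lemma div_sub_sq_eq_one_add {k l V : ℝ} (h : k - V ^ 2 ≠ 0) :
    (l - V ^ 2) / (k - V ^ 2) = 1 + (l - k) * (k - V ^ 2)⁻¹ := by
  field_simp
  ring

lemma strictMonoOn_neg_inv_sub_sq {k : ℝ} (hk : 0 < k) :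
    StrictMonoOn (fun V : ℝ => -(k - V ^ 2)⁻¹) (Ioc (-√k) 0) := by
  intro x hx y hy hxy
  have hpos := sub_sq_pos_of_neg_sqrt_lt hk hx.1 hx.2
  have hlt : k - x ^ 2 < k - y ^ 2 := by nlinarith [hy.2]
  exact neg_lt_neg (inv_strictAnti₀ hpos hlt)

lemma tendsto_inv_sub_sq_atTop {k : ℝ} (hk : 0 < k) :
    Tendsto (fun V : ℝ => (k - V ^ 2)⁻¹) (𝓝[>] (-√k)) atTop := by
  refine tendsto_inv_nhdsGT_zero.comp (tendsto_nhdsWithin_iff.2 ⟨?_, ?_⟩)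
  · have hcont : Continuous fun V : ℝ => k - V ^ 2 := by fun_prop
    have h := hcont.tendsto (-√k)
    rw [neg_sq, Real.sq_sqrt hk.le, sub_self] at h
    exact h.mono_left nhdsWithin_le_nhds
  · filter_upwards [Ioc_mem_nhdsGT (neg_lt_zero.2 (Real.sqrt_pos.2 hk))] with V hV
    exact sub_sq_pos_of_neg_sqrt_lt hk hV.1 hV.2

/-- Properties of the minimal entropy dissipation function `ψ̲`:
strictly increasing on `(−c3, 0]`, tending to `−∞` as `V → −c3⁺`, and
negative on `(−c3, 0]` when `k3·w_m < k1·w_M`. -/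
theorem stmt_8 (k1 k3 wM wm c1 c3 : ℝ)
    (hk3 : 0 < k3) (hk13 : k3 < k1) (hwM : 0 < wM) (hwMm : wM < wm)
    (hc1 : c1 = Real.sqrt k1) (hc3 : c3 = Real.sqrt k3)
    (ψ : ℝ → ℝ)
    (hψ : ∀ V, ψ V = ((k1 - k3) / 2) * wM *
      (wm - ((k1 - V ^ 2) / (k3 - V ^ 2)) * wM)) :
    StrictMonoOn ψ (Ioc (-c3) 0) ∧
    Tendsto ψ (nhdsWithin (-c3) (Ioi (-c3))) atBot ∧
    (k3 * wm < k1 * wM → ∀ V ∈ Ioc (-c3) (0:ℝ), ψ V < 0) := by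
  subst hc3
  have hd : 0 < k1 - k3 := sub_pos.2 hk13
  have ha : 0 < (k1 - k3) / 2 * wM := by positivity
  have hb : 0 < (k1 - k3) / 2 * wM * ((k1 - k3) * wM) := by positivity
  have hform : EqOn ψ (fun V => (k1 - k3) / 2 * wM * (wm - wM) +
      (k1 - k3) / 2 * wM * ((k1 - k3) * wM) * -(k3 - V ^ 2)⁻¹) (Ioc (-√k3) 0) := by
    intro V hV
    simp only [hψ, div_sub_sq_eq_one_add (sub_sq_pos_of_neg_sqrt_lt hk3 hV.1 hV.2).ne']
    ring
  have hc3 : -√k3 < 0 := neg_lt_zero.2 (Real.sqrt_pos.2 hk3)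
  have hmono : StrictMonoOn ψ (Ioc (-√k3) 0) := by
    refine StrictMonoOn.congr (fun x hx y hy hxy => ?_) hform.symm
    have h := strictMonoOn_neg_inv_sub_sq hk3 hx hy hxy
    exact add_lt_add_right (mul_lt_mul_of_pos_left h hb) _
  refine ⟨hmono, ?_, fun h V hV => ?_⟩
  · refine Tendsto.congr' (hform.symm.eventuallyEq_of_mem (Ioc_mem_nhdsGT hc3)) ?_
    exact tendsto_atBot_add_const_left _ _
      ((tendsto_neg_atTop_atBot.comp (tendsto_inv_sub_sq_atTop hk3)).const_mul_atBot hb)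
  · refine (hmono.monotoneOn hV ⟨hc3, le_rfl⟩ hV.2).trans_lt ?_
    have hlt : wm < k1 / k3 * wM := by
      rw [div_mul_eq_mul_div, lt_div_iff₀ hk3]
      linarith
    rw [hψ]
    refine mul_neg_of_pos_of_neg ha ?_
    simpa using hlt
end

section
/- The function ψ̄(V) = ((k1 − k3)/2)·w_m·(w_M − ((k3 − V²)/(k1 − V²))·w_m) is strictly increasing on [0, c3] and satisfies ψ̄(c3) = ((k1 − k3)/2)·w_M·w_m. If moreover k3·w_m < k1·w_M, then ψ̄(V) > 0 for every V ∈ [0, c3]. -/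
open Set

/-- Properties of the maximal entropy dissipation function `ψ̄`:
strictly increasing on `[0, c3]`, with `ψ̄(c3) = ((k1−k3)/2)·w_M·w_m`, and
positive on `[0, c3]` when `k3·w_m < k1·w_M`. -/
theorem stmt_9 (k1 k3 wM wm c1 c3 : ℝ)
    (hk3 : 0 < k3) (hk13 : k3 < k1) (hwM : 0 < wM) (hwMm : wM < wm)
    (hc1 : c1 = Real.sqrt k1) (hc3 : c3 = Real.sqrt k3)
    (ψ : ℝ → ℝ)
    (hψ : ∀ V, ψ V = ((k1 - k3) / 2) * wm *
      (wM - ((k3 - V ^ 2) / (k1 - V ^ 2)) * wm)) :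
    StrictMonoOn ψ (Icc 0 c3) ∧
    ψ c3 = ((k1 - k3) / 2) * (wM * wm) ∧
    (k3 * wm < k1 * wM → ∀ V ∈ Icc (0:ℝ) c3, 0 < ψ V) := by
  have hsq : c3 ^ 2 = k3 := by rw [hc3, Real.sq_sqrt hk3.le]
  have hc3_nonneg : 0 ≤ c3 := hc3 ▸ Real.sqrt_nonneg k3
  have hwm : 0 < wm := hwM.trans hwMm
  have hcoeff : 0 < (k1 - k3) / 2 * wm := mul_pos (by linarith) hwm
  have hmono : StrictMonoOn ψ (Icc 0 c3) := by
    rintro a ⟨ha, -⟩ b ⟨-, hb⟩ hab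
    have hab_sq : a ^ 2 < b ^ 2 := pow_lt_pow_left₀ hab ha two_ne_zero
    have hb_sq : b ^ 2 ≤ k3 := hsq ▸ pow_le_pow_left₀ (ha.trans hab.le) hb 2
    have hfrac : (k3 - b ^ 2) / (k1 - b ^ 2) < (k3 - a ^ 2) / (k1 - a ^ 2) := by
      rw [div_lt_div_iff₀ (by linarith) (by linarith)]
      nlinarith [mul_pos (sub_pos.2 hk13) (sub_pos.2 hab_sq)]
    rw [hψ, hψ]
    gcongr
  refine ⟨hmono, ?_, fun h V hV => ?_⟩
  · rw [hψ, hsq, sub_self, zero_div]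
    ring
  · have hzero : 0 < ψ 0 := by
      have hk1 : 0 < k1 := hk3.trans hk13
      rw [hψ]
      refine mul_pos hcoeff (sub_pos.2 ?_)
      rw [zero_pow two_ne_zero, sub_zero, sub_zero, div_mul_eq_mul_div, div_lt_iff₀ hk1]
      linarith
    exact hzero.trans_le (hmono.monotoneOn (left_mem_Icc.2 hc3_nonneg) hV hV.1)
end

section
/- Assume in addition that φ(V) < ((k1 − k3)/2)·w_M·w_m for every V ∈ (−c3, c3). Then the root V(h) of the kinetic equation satisfies V(h) → c3 as h → 0⁺. -/
open Set Filter Topology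

/-- Bound for the strain ratio on the subsonic interval, away from the endpoint `c3`. -/
lemma strainRatio_le {c1 c3 a V : ℝ} (hc3 : 0 < c3) (hc : c3 < c1) (ha : a < c3)
    (hV : -c3 < V) (hVa : V ≤ a) :
    ((c3 + V) * (c1 - V)) / ((c1 + V) * (c3 - V)) ≤
      ((2 * c3) * (c1 + c3)) / ((c1 - c3) * (c3 - a)) := by
  have h1 : 0 < c1 - c3 := by linarith
  have h2 : 0 < c3 - a := by linarith
  have h3 : 0 ≤ c1 - V := by linarith
  have h4 : 0 ≤ c1 + V := by linarith
  have h5 : 0 ≤ (2 * c3) * (c1 + c3) := by nlinarith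
  gcongr <;> linarith

/-- First limit in (2.10c): if moreover `φ < ((k1−k3)/2)·w_M·w_m` everywhere
on `(−c3, c3)`, then the root `V(h)` of the kinetic equation tends to `c3`
as `h → 0⁺`. -/
theorem stmt_10 (k1 k3 wM wm c1 c3 : ℝ)
    (hk3 : 0 < k3) (hk13 : k3 < k1) (hwM : 0 < wM) (hwMm : wM < wm)
    (hc1 : c1 = Real.sqrt k1) (hc3 : c3 = Real.sqrt k3)
    (φ : ℝ → ℝ)
    (hφc : ContinuousOn φ (Ioo (-c3) c3))
    (hφm : MonotoneOn φ (Ioo (-c3) c3))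
    (hφlim : Tendsto φ (nhdsWithin (-c3) (Ioi (-c3))) atBot)
    (hφub : ∀ V ∈ Ioo (-c3) c3, φ V < ((k1 - k3) / 2) * (wM * wm))
    (θ : ℝ → ℝ → ℝ)
    (hθ : ∀ h V, θ h V = ((k1 - k3) / 2) *
      (wM * wm - (((c3 + V) * (c1 - V)) / ((c1 + V) * (c3 - V))) * h ^ 2))
    (Vf : ℝ → ℝ)
    (hVf : ∀ h : ℝ, 0 < h → Vf h ∈ Ioo (-c3) c3 ∧ θ h (Vf h) = φ (Vf h)) :
    Tendsto Vf (nhdsWithin 0 (Ioi 0)) (nhds c3) := by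
  have hc3pos : 0 < c3 := hc3 ▸ Real.sqrt_pos.2 hk3
  have hc : c3 < c1 := by
    rw [hc1, hc3]
    exact Real.sqrt_lt_sqrt hk3.le hk13
  refine tendsto_order.2 ⟨fun b hb => ?_, fun b hb => ?_⟩
  · obtain ⟨a, hba, ha0, hac⟩ : ∃ a, b ≤ a ∧ 0 ≤ a ∧ a < c3 :=
      ⟨max b 0, le_max_left _ _, le_max_right _ _, max_lt hb hc3pos⟩
    have ha : a ∈ Ioo (-c3) c3 := ⟨by linarith, hac⟩
    set B := ((2 * c3) * (c1 + c3)) / ((c1 - c3) * (c3 - a))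
    have hlim : Tendsto (fun h : ℝ => (k1 - k3) / 2 * (B * h ^ 2)) (𝓝[>] 0) (𝓝 0) := by
      have hcont : Continuous fun h : ℝ => (k1 - k3) / 2 * (B * h ^ 2) := by fun_prop
      simpa using (hcont.tendsto 0).mono_left nhdsWithin_le_nhds
    filter_upwards [hlim.eventually (gt_mem_nhds (sub_pos.2 (hφub a ha))),
      self_mem_nhdsWithin] with h hsmall hpos
    obtain ⟨hV, hroot⟩ := hVf h hpos
    by_contra! hle
    have hVa : Vf h ≤ a := hle.trans hba
    have hmono := hφm hV ha hVa
    have hK : 0 ≤ (k1 - k3) / 2 := by linarith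
    have hbound := mul_le_mul_of_nonneg_left (mul_le_mul_of_nonneg_right
      (strainRatio_le hc3pos hc hac hV.1 hVa) (sq_nonneg h)) hK
    rw [hθ, mul_sub] at hroot
    linarith
  · filter_upwards [self_mem_nhdsWithin] with h hpos
    exact (hVf h hpos).1.2.trans hb
end

section
/- The root map h ↦ V(h) is continuous and strictly decreasing on (0, ∞): if 0 < h1 < h2 then V(h2) < V(h1). -/
open Set Filter Topology

/-- The ratio `((a + x) (b - x)) / ((b + x) (a - x))` is strictly increasing on `(-a, a)`
when `a < b`. -/
theorem strictMonoOn_ratio {a b : ℝ} (hab : a < b) :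
    StrictMonoOn (fun x : ℝ => ((a + x) * (b - x)) / ((b + x) * (a - x))) (Ioo (-a) a) := by
  rintro x ⟨hx1, hx2⟩ y ⟨hy1, hy2⟩ hxy
  have h1 : (a + x) * (b + y) < (a + y) * (b + x) := by nlinarith
  have h2 : (b - x) * (a - y) < (b - y) * (a - x) := by nlinarith
  have h3 := mul_lt_mul'' h1 h2
    (mul_nonneg (by linarith) (by linarith)) (mul_nonneg (by linarith) (by linarith))
  have hx : 0 < (b + x) * (a - x) := mul_pos (by linarith) (by linarith)
  have hy : 0 < (b + y) * (a - y) := mul_pos (by linarith) (by linarith)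
  change _ / _ < _ / _
  rw [div_lt_div_iff₀ hx hy]
  linarith

/-- Continuity/monotonicity part of Lemma 2.1: the root map `h ↦ V(h)` of the
kinetic equation is continuous and strictly decreasing on `(0, ∞)`. -/
theorem stmt_11 (k1 k3 wM wm c1 c3 : ℝ)
    (hk3 : 0 < k3) (hk13 : k3 < k1) (hwM : 0 < wM) (hwMm : wM < wm)
    (hc1 : c1 = Real.sqrt k1) (hc3 : c3 = Real.sqrt k3)
    (φ : ℝ → ℝ)
    (hφc : ContinuousOn φ (Ioo (-c3) c3))
    (hφm : MonotoneOn φ (Ioo (-c3) c3))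
    (hφlim : Tendsto φ (nhdsWithin (-c3) (Ioi (-c3))) atBot)
    (θ : ℝ → ℝ → ℝ)
    (hθ : ∀ h V, θ h V = ((k1 - k3) / 2) *
      (wM * wm - (((c3 + V) * (c1 - V)) / ((c1 + V) * (c3 - V))) * h ^ 2))
    (Vf : ℝ → ℝ)
    (hVf : ∀ h : ℝ, 0 < h → Vf h ∈ Ioo (-c3) c3 ∧ θ h (Vf h) = φ (Vf h)) :
    ContinuousOn Vf (Ioi 0) ∧ StrictAntiOn Vf (Ioi 0) := by
  have hc : c3 < c1 := by
    rw [hc1, hc3]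
    exact Real.sqrt_lt_sqrt hk3.le hk13
  have hk : 0 < (k1 - k3) / 2 := by linarith
  have hθV : ∀ h, 0 < h → StrictAntiOn (θ h) (Ioo (-c3) c3) := by
    intro h hh x hx y hy hxy
    rw [hθ, hθ]
    exact mul_lt_mul_of_pos_left (sub_lt_sub_left
      (mul_lt_mul_of_pos_right (strictMonoOn_ratio hc hx hy hxy) (by positivity)) _) hk
  have hθh : ∀ V ∈ Ioo (-c3) c3, ∀ h₁ h₂, 0 < h₁ → h₁ < h₂ → θ h₂ V < θ h₁ V := by
    rintro V ⟨hV1, hV2⟩ h₁ h₂ hh₁ hh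
    have hg : 0 < ((c3 + V) * (c1 - V)) / ((c1 + V) * (c3 - V)) :=
      div_pos (mul_pos (by linarith) (by linarith)) (mul_pos (by linarith) (by linarith))
    rw [hθ, hθ]
    exact mul_lt_mul_of_pos_left (sub_lt_sub_left
      (mul_lt_mul_of_pos_left (pow_lt_pow_left₀ hh hh₁.le two_ne_zero) hg) _) hk
  have hθc : ∀ V, Continuous fun h => θ h V := by
    intro V
    simp only [hθ]
    fun_prop
  refine ⟨fun h₀ hh₀ => ?_, fun h₁ hh₁ h₂ hh₂ hh => ?_⟩
  · obtain ⟨hV₀, hroot₀⟩ := hVf h₀ hh₀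
    have hpos : ∀ᶠ h in 𝓝[Ioi 0] h₀, (0 : ℝ) < h := self_mem_nhdsWithin
    refine tendsto_order.2 ⟨fun a ha => ?_, fun b hb => ?_⟩
    · rcases le_or_gt a (-c3) with hac | hac
      · filter_upwards [hpos] with h hh using hac.trans_lt (hVf h hh).1.1
      · have haI : a ∈ Ioo (-c3) c3 := ⟨hac, ha.trans hV₀.2⟩
        have hlt : φ a < θ h₀ a :=
          (hφm haI hV₀ ha.le).trans_lt (hroot₀ ▸ hθV h₀ hh₀ haI hV₀ ha)
        have hev : ∀ᶠ h in 𝓝[Ioi 0] h₀, φ a < θ h a :=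
          ((hθc a).continuousWithinAt).eventually (lt_mem_nhds hlt)
        filter_upwards [hpos, hev] with h hh hha
        obtain ⟨hV, hroot⟩ := hVf h hh
        by_contra! hle
        have h1 := (hθV h hh).antitoneOn hV haI hle
        have h2 := hφm hV haI hle
        linarith
    · rcases le_or_gt c3 b with hbc | hbc
      · filter_upwards [hpos] with h hh using (hVf h hh).1.2.trans_le hbc
      · have hbI : b ∈ Ioo (-c3) c3 := ⟨hV₀.1.trans hb, hbc⟩
        have hlt : θ h₀ b < φ b :=
          (hθV h₀ hh₀ hV₀ hbI hb).trans_le (hroot₀ ▸ hφm hV₀ hbI hb.le)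
        have hev : ∀ᶠ h in 𝓝[Ioi 0] h₀, θ h b < φ b :=
          ((hθc b).continuousWithinAt).eventually (gt_mem_nhds hlt)
        filter_upwards [hpos, hev] with h hh hhb
        obtain ⟨hV, hroot⟩ := hVf h hh
        by_contra! hle
        have h1 := (hθV h hh).antitoneOn hbI hV hle
        have h2 := hφm hbI hV hle
        linarith
  · obtain ⟨hV₁, hroot₁⟩ := hVf h₁ hh₁
    obtain ⟨hV₂, hroot₂⟩ := hVf h₂ hh₂
    by_contra! hle
    have h1 := hθh _ hV₂ h₁ h₂ hh₁ hh
    have h2 := (hθV h₁ hh₁).antitoneOn hV₁ hV₂ hle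
    have h3 := hφm hV₁ hV₂ hle
    linarith
end

section
/- Assume in addition that φ(V) < ((k1 − k3)/2)·w_M·w_m for every V ∈ (−c3, c3), and that the limit φ'(c3) := lim_{V→c3⁻} ( ((k1 − k3)/2)·w_M·w_m − φ(V) )/(c3 − V) exists and is positive. Then (c3 − V(h))/h → (c1 − c3)·√(c3/φ'(c3)) as h → 0⁺. -/
open Set Filter Topology

/-- Derivative limit in (2.10c): if the one-sided limit `φ'(c3)` exists and is
positive, then `(c3 − V(h))/h → (c1 − c3)·√(c3/φ'(c3))` as `h → 0⁺`. -/
theorem stmt_12 (k1 k3 wM wm c1 c3 : ℝ)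
    (hk3 : 0 < k3) (hk13 : k3 < k1) (hwM : 0 < wM) (hwMm : wM < wm)
    (hc1 : c1 = Real.sqrt k1) (hc3 : c3 = Real.sqrt k3)
    (φ : ℝ → ℝ)
    (hφc : ContinuousOn φ (Ioo (-c3) c3))
    (hφm : MonotoneOn φ (Ioo (-c3) c3))
    (hφlim : Tendsto φ (nhdsWithin (-c3) (Ioi (-c3))) atBot)
    (hφub : ∀ V ∈ Ioo (-c3) c3, φ V < ((k1 - k3) / 2) * (wM * wm))
    (φ'c3 : ℝ) (hφ'pos : 0 < φ'c3)
    (hφ' : Tendsto (fun V => (((k1 - k3) / 2) * (wM * wm) - φ V) / (c3 - V))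
      (nhdsWithin c3 (Iio c3)) (nhds φ'c3))
    (θ : ℝ → ℝ → ℝ)
    (hθ : ∀ h V, θ h V = ((k1 - k3) / 2) *
      (wM * wm - (((c3 + V) * (c1 - V)) / ((c1 + V) * (c3 - V))) * h ^ 2))
    (Vf : ℝ → ℝ)
    (hVf : ∀ h : ℝ, 0 < h → Vf h ∈ Ioo (-c3) c3 ∧ θ h (Vf h) = φ (Vf h)) :
    Tendsto (fun h => (c3 - Vf h) / h) (nhdsWithin 0 (Ioi 0))
      (nhds ((c1 - c3) * Real.sqrt (c3 / φ'c3))) := by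
  have hc3p : 0 < c3 := hc3 ▸ Real.sqrt_pos.2 hk3
  have hc13 : c3 < c1 := by
    rw [hc1, hc3]
    exact Real.sqrt_lt_sqrt hk3.le hk13
  have hk : k1 - k3 = (c1 - c3) * (c1 + c3) := by
    have e1 : c1 ^ 2 = k1 := by rw [hc1, Real.sq_sqrt (hk3.trans hk13).le]
    have e3 : c3 ^ 2 = k3 := by rw [hc3, Real.sq_sqrt hk3.le]
    rw [← e1, ← e3]
    ring
  have hK : 0 < (k1 - k3) / 2 := by linarith
  set K := (k1 - k3) / 2 with hKdef
  have key : ∀ h, 0 < h → (K * (wM * wm) - φ (Vf h)) * ((c3 - Vf h) * (c1 + Vf h)) =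
      K * ((c3 + Vf h) * (c1 - Vf h)) * h ^ 2 := by
    intro h hh
    obtain ⟨⟨hl, hu⟩, he⟩ := hVf h hh
    have h1 : c1 + Vf h ≠ 0 := by linarith
    have h2 : c3 - Vf h ≠ 0 := by linarith
    rw [← he, hθ]
    field_simp
    ring
  have hpos : ∀ᶠ h : ℝ in 𝓝[>] 0, 0 < h := self_mem_nhdsWithin
  have hV : Tendsto Vf (𝓝[>] 0) (𝓝[<] c3) := by
    refine tendsto_nhdsWithin_iff.2 ⟨tendsto_order.2 ⟨fun a ha => ?_, fun a ha => ?_⟩, ?_⟩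
    · have hb : max a 0 ∈ Ioo (-c3) c3 :=
        ⟨(neg_lt_zero.2 hc3p).trans_le (le_max_right _ _), max_lt ha hc3p⟩
      have hδ : 0 < (K * (wM * wm) - φ (max a 0)) * ((c3 - max a 0) * (c1 - c3)) :=
        mul_pos (sub_pos.2 (hφub _ hb)) (mul_pos (sub_pos.2 hb.2) (sub_pos.2 hc13))
      have hlim : Tendsto (fun h : ℝ => K * ((2 * c3) * (c1 + c3)) * h ^ 2) (𝓝[>] 0) (𝓝 0) := by
        have : Continuous (fun h : ℝ => K * ((2 * c3) * (c1 + c3)) * h ^ 2) := by fun_prop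
        simpa using (this.tendsto 0).mono_left nhdsWithin_le_nhds
      filter_upwards [hpos, hlim.eventually_lt_const hδ] with h hh hlt
      by_contra! hle
      obtain ⟨hl, hu⟩ := (hVf h hh).1
      have hm : Vf h ≤ max a 0 := hle.trans (le_max_left _ _)
      have hφle := hφm ⟨hl, hu⟩ hb hm
      have lower : (K * (wM * wm) - φ (max a 0)) * ((c3 - max a 0) * (c1 - c3)) ≤
          (K * (wM * wm) - φ (Vf h)) * ((c3 - Vf h) * (c1 + Vf h)) := by
        have := hφub _ ⟨hl, hu⟩
        have := hb.2
        apply mul_le_mul (by linarith) _ (by apply mul_nonneg <;> linarith) (by linarith)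
        apply mul_le_mul <;> linarith
      have upper : K * ((c3 + Vf h) * (c1 - Vf h)) * h ^ 2 ≤
          K * ((2 * c3) * (c1 + c3)) * h ^ 2 := by
        have : (c3 + Vf h) * (c1 - Vf h) ≤ (2 * c3) * (c1 + c3) := by
          apply mul_le_mul <;> linarith
        gcongr
      linarith [key h hh]
    · filter_upwards [hpos] with h hh using (hVf h hh).1.2.trans ha
    · filter_upwards [hpos] with h hh using (hVf h hh).1.2
  have hquot : Tendsto (fun V => K * ((c3 + V) * (c1 - V) / (c1 + V)) /
      ((K * (wM * wm) - φ V) / (c3 - V))) (𝓝[<] c3)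
      (𝓝 (K * ((c3 + c3) * (c1 - c3) / (c1 + c3)) / φ'c3)) := by
    refine Tendsto.div (Tendsto.mono_left ?_ nhdsWithin_le_nhds) hφ' hφ'pos.ne'
    have : ContinuousAt (fun V => K * ((c3 + V) * (c1 - V) / (c1 + V))) c3 := by
      fun_prop (disch := linarith)
    exact this
  have hval : Real.sqrt (K * ((c3 + c3) * (c1 - c3) / (c1 + c3)) / φ'c3) =
      (c1 - c3) * Real.sqrt (c3 / φ'c3) := by
    have e : K * ((c3 + c3) * (c1 - c3) / (c1 + c3)) / φ'c3 = (c1 - c3) ^ 2 * (c3 / φ'c3) := by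
      have : c1 + c3 ≠ 0 := by linarith
      rw [hKdef, hk]
      field_simp
      ring
    rw [e, Real.sqrt_mul (sq_nonneg _), Real.sqrt_sq (by linarith)]
  rw [← hval]
  refine (hquot.comp hV).sqrt.congr' ?_
  filter_upwards [hpos] with h hh
  obtain ⟨hl, hu⟩ := (hVf h hh).1
  have h1 : c1 + Vf h ≠ 0 := by linarith
  have h2 : 0 < c3 - Vf h := by linarith
  have h3 : K * (wM * wm) - φ (Vf h) ≠ 0 := (sub_pos.2 (hφub _ ⟨hl, hu⟩)).ne'
  have hkey := key h hh
  rw [Real.sqrt_eq_iff_mul_self_eq_of_pos (div_pos h2 hh), Function.comp_apply]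
  clear_value K
  generalize K * (wM * wm) - φ (Vf h) = A at hkey h3 ⊢
  have e : K * ((c3 + Vf h) * (c1 - Vf h) / (c1 + Vf h)) = A * (c3 - Vf h) / h ^ 2 := by
    rw [mul_div_assoc', div_eq_div_iff h1 (by positivity), ← hkey]
    ring
  rw [e]
  field_simp
end

section
/- Assume in addition that φ(V) < ((k1 − k3)/2)·w_M·w_m for every V ∈ (−c3, c3), and that the limit φ'(c3) := lim_{V→c3⁻} ( ((k1 − k3)/2)·w_M·w_m − φ(V) )/(c3 − V) exists and is positive. Then the right strain w_+(h) := ((c1 − V(h))/(c3 − V(h)))·h satisfies w_+(h) → √(φ'(c3)/c3) as h → 0⁺. -/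
open Set Filter Topology

/-- Limit (2.10b): if the one-sided limit `φ'(c3)` exists and is
positive, then the right strain `w₊(h) = ((c1 − V(h))/(c3 − V(h)))·h` tends
to `√(φ'(c3)/c3)` as `h → 0⁺`. -/
theorem stmt_13 (k1 k3 wM wm c1 c3 : ℝ)
    (hk3 : 0 < k3) (hk13 : k3 < k1) (hwM : 0 < wM) (hwMm : wM < wm)
    (hc1 : c1 = Real.sqrt k1) (hc3 : c3 = Real.sqrt k3)
    (φ : ℝ → ℝ)
    (hφc : ContinuousOn φ (Ioo (-c3) c3))
    (hφm : MonotoneOn φ (Ioo (-c3) c3))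
    (hφlim : Tendsto φ (nhdsWithin (-c3) (Ioi (-c3))) atBot)
    (hφub : ∀ V ∈ Ioo (-c3) c3, φ V < ((k1 - k3) / 2) * (wM * wm))
    (φ'c3 : ℝ) (hφ'pos : 0 < φ'c3)
    (hφ' : Tendsto (fun V => (((k1 - k3) / 2) * (wM * wm) - φ V) / (c3 - V))
      (nhdsWithin c3 (Iio c3)) (nhds φ'c3))
    (θ : ℝ → ℝ → ℝ)
    (hθ : ∀ h V, θ h V = ((k1 - k3) / 2) *
      (wM * wm - (((c3 + V) * (c1 - V)) / ((c1 + V) * (c3 - V))) * h ^ 2))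
    (Vf : ℝ → ℝ)
    (hVf : ∀ h : ℝ, 0 < h → Vf h ∈ Ioo (-c3) c3 ∧ θ h (Vf h) = φ (Vf h)) :
    Tendsto (fun h => ((c1 - Vf h) / (c3 - Vf h)) * h) (nhdsWithin 0 (Ioi 0))
      (nhds (Real.sqrt (φ'c3 / c3))) := by
  have hc3pos : 0 < c3 := hc3 ▸ Real.sqrt_pos.2 hk3
  have hc31 : c3 < c1 := by
    rw [hc1, hc3]; exact Real.sqrt_lt_sqrt hk3.le hk13
  have hk1sq : k1 = c1 ^ 2 := by rw [hc1, Real.sq_sqrt (hk3.trans hk13).le]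
  have hk3sq : k3 = c3 ^ 2 := by rw [hc3, Real.sq_sqrt hk3.le]
  have hk : 0 < k1 - k3 := sub_pos.2 hk13
  have hpos : ∀ᶠ h : ℝ in 𝓝[>] 0, 0 < h := self_mem_nhdsWithin
  have hbalance : ∀ h : ℝ, 0 < h → (k1 - k3) / 2 * (wM * wm) - φ (Vf h) =
      (k1 - k3) / 2 *
        ((c3 + Vf h) * (c1 - Vf h) / ((c1 + Vf h) * (c3 - Vf h))) * h ^ 2 := by
    intro h hh
    rw [← (hVf h hh).2, hθ]
    ring
  have hV : Tendsto Vf (𝓝[>] 0) (𝓝[<] c3) := by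
    refine tendsto_nhdsWithin_iff.2 ⟨tendsto_order.2 ⟨fun a ha => ?_, fun a ha => ?_⟩, ?_⟩
    · obtain ⟨b, hb, hbc⟩ := exists_between (max_lt ha (neg_lt_self hc3pos))
      obtain ⟨hab, hcb⟩ := max_lt_iff.1 hb
      have hsmall : Tendsto (fun h : ℝ => (k1 - k3) / 2 *
          (2 * c3 * (c1 + c3) / ((c1 - c3) * (c3 - b))) * h ^ 2) (𝓝[>] 0) (𝓝 0) := by
        refine tendsto_nhdsWithin_of_tendsto_nhds (Continuous.tendsto' (by fun_prop) _ _ ?_)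
        simp
      filter_upwards [hpos, hsmall.eventually_lt_const (sub_pos.2 (hφub b ⟨hcb, hbc⟩))]
        with h hh hlt
      refine hab.trans (lt_of_not_ge fun hVb => hlt.not_ge ?_)
      obtain ⟨hV1, hV2⟩ := (hVf h hh).1
      have hφle := hφm (hVf h hh).1 ⟨hcb, hbc⟩ hVb
      calc (k1 - k3) / 2 * (wM * wm) - φ b ≤ (k1 - k3) / 2 * (wM * wm) - φ (Vf h) := by
            linarith
        _ = _ := hbalance h hh
        _ ≤ _ := by
          have h1 : 0 < c1 - c3 := by linarith
          have h2 : 0 < c3 - b := by linarith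
          have h3 : 0 ≤ c1 - Vf h := by linarith
          have h4 : 0 < c1 := by linarith
          have h5 : 0 ≤ 2 * c3 * (c1 + c3) := by positivity
          gcongr <;> linarith
    · filter_upwards [hpos] with h hh using (hVf h hh).1.2.trans ha
    · filter_upwards [hpos] with h hh using (hVf h hh).1.2
  have hfactor : Tendsto (fun V => (c1 - V) * (c1 + V) / ((k1 - k3) / 2 * (c3 + V)))
      (𝓝[<] c3) (𝓝 ((c1 - c3) * (c1 + c3) / ((k1 - k3) / 2 * (c3 + c3)))) := by
    refine tendsto_nhdsWithin_of_tendsto_nhds (ContinuousAt.tendsto ?_)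
    have : (k1 - k3) / 2 * (c3 + c3) ≠ 0 := by positivity
    fun_prop (disch := assumption)
  have hlim : (c1 - c3) * (c1 + c3) / ((k1 - k3) / 2 * (c3 + c3)) * φ'c3 = φ'c3 / c3 := by
    have hprod : (c1 - c3) * (c1 + c3) = k1 - k3 := by rw [hk1sq, hk3sq]; ring
    rw [hprod]
    field_simp
    ring
  rw [← hlim]
  refine ((hfactor.mul hφ').comp hV).sqrt.congr' ?_
  filter_upwards [hpos] with h hh
  obtain ⟨hV1, hV2⟩ := (hVf h hh).1
  have h1 : 0 < c1 - Vf h := by linarith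
  have h2 : 0 < c3 - Vf h := by linarith
  have h3 : 0 < c1 + Vf h := by linarith
  have h4 : 0 < c3 + Vf h := by linarith
  rw [Real.sqrt_eq_iff_mul_self_eq_of_pos (by positivity)]
  simp only [Function.comp_apply]
  rw [hbalance h hh]
  field_simp
end

section
/- Let V ∈ (−c3, c3) and let w_−, w_+ satisfy w_− ≤ w_M, w_+ ≥ w_m and the Rankine–Hugoniot condition w_−·(k1 − V²) = w_+·(k3 − V²). Then the entropy dissipation D := ((k1 − k3)/2)·(w_M·w_m − w_+·w_−) satisfies ψ̲(V) ≤ D ≤ ψ̄(V). -/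
open Set

/-- Remark 1.2(1): across any subsonic phase boundary of speed `V` joining a
phase-1 strain `w₋` to a phase-3 strain `w₊`, the entropy dissipation
`D = ((k1−k3)/2)·(w_M·w_m − w₊·w₋)` lies between `ψ̲(V)` and `ψ̄(V)`. -/
theorem stmt_16 (k1 k3 wM wm c1 c3 : ℝ)
    (hk3 : 0 < k3) (hk13 : k3 < k1) (hwM : 0 < wM) (hwMm : wM < wm)
    (hc1 : c1 = Real.sqrt k1) (hc3 : c3 = Real.sqrt k3)
    (V wminus wplus : ℝ) (hV : V ∈ Ioo (-c3) c3)
    (h1 : wminus ≤ wM) (h2 : wm ≤ wplus)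
    (hRH : wminus * (k1 - V ^ 2) = wplus * (k3 - V ^ 2)) :
    ((k1 - k3) / 2) * wM * (wm - ((k1 - V ^ 2) / (k3 - V ^ 2)) * wM) ≤
      ((k1 - k3) / 2) * (wM * wm - wplus * wminus) ∧
    ((k1 - k3) / 2) * (wM * wm - wplus * wminus) ≤
      ((k1 - k3) / 2) * wm * (wM - ((k3 - V ^ 2) / (k1 - V ^ 2)) * wm) := by
  have hV2 : V ^ 2 < k3 := by
    rw [hc3] at hV
    exact Real.sq_lt.2 hV
  have hb : 0 < k3 - V ^ 2 := by linarith
  have ha : 0 < k1 - V ^ 2 := by linarith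
  have hk : 0 ≤ (k1 - k3) / 2 := by linarith
  have hwm : 0 < wm := hwM.trans hwMm
  have hp : 0 < wplus := hwm.trans_le h2
  have hm : 0 < wminus := pos_of_mul_pos_left (hRH ▸ mul_pos hp hb) ha.le
  have e1 : wplus = (k1 - V ^ 2) / (k3 - V ^ 2) * wminus := by
    field_simp
    linarith
  have e2 : wminus = (k3 - V ^ 2) / (k1 - V ^ 2) * wplus := by
    field_simp
    linarith
  have upper : wplus * wminus ≤ (k1 - V ^ 2) / (k3 - V ^ 2) * wM * wM := by
    rw [e1]
    gcongr
  have lower : (k3 - V ^ 2) / (k1 - V ^ 2) * wm * wm ≤ wminus * wplus := by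
    rw [e2]
    gcongr
  constructor
  · rw [mul_assoc]
    exact mul_le_mul_of_nonneg_left (by linarith) hk
  · rw [mul_assoc]
    exact mul_le_mul_of_nonneg_left (by linarith) hk
end
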